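/- arXiv:2002.12874 — 2 statements merged into one kernel-verified Lean document; each statement's English description precedes it below -/
import Mathlib

section
/- Let A ∈ ℤ[[s,z]] be the power series in which the coefficient of s^k z^n is the number of grand Dyck paths P ∈ 𝒢_n with ds(P) = k, and let C(z) = Σ_{n≥0} Cat_n z^n be the generating function of the Catalan numbers. Then A·(2(1−s)z + 1 − 2zC(z)) = 1 in ℤ[[s,z]]. (Since 1−2zC(z) is the power-series square root of 1−4z, this is the identity A = 1/(2(1−s)z + √(1−4z)).) -/
/-- The height of the lattice path encoded by `w` (with `true = U = (1,1)` and
`false = D = (1,-1)`) after `j` steps. -/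
def ht (w : List Bool) (j : ℕ) : ℤ :=
  ((w.take j).count true : ℤ) - ((w.take j).count false : ℤ)

/-- A grand Dyck path of semilength `n`: a word of length `2n` over `{U,D}` with exactly
`n` letters `U` (encoded as `true`) and `n` letters `D` (encoded as `false`). -/
def IsGrandDyck (n : ℕ) (w : List Bool) : Prop :=
  w.length = 2 * n ∧ w.count true = n

/-- The degree of symmetry of a grand Dyck path of semilength `n`: the number of
`i ∈ {1,…,n}` such that `h_{i−1} = h_{2n+1−i}` and `h_i = h_{2n−i}`. -/
def dsGD (n : ℕ) (w : List Bool) : ℕ :=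
  ((Finset.Icc 1 n).filter fun i =>
    ht w (i - 1) = ht w (2 * n + 1 - i) ∧ ht w i = ht w (2 * n - i)).card

/-- The series `A ∈ ℤ[[s,z]]` whose coefficient of `s^k z^n` is the number of grand Dyck
paths of semilength `n` with degree of symmetry `k`. Variable `0` is `s`, variable `1` is `z`. -/
noncomputable def A : MvPowerSeries (Fin 2) ℤ := fun d =>
  ({w : List Bool | IsGrandDyck (d 1) w ∧ dsGD (d 1) w = d 0}.ncard : ℤ)

/-- The Catalan generating function `C(z) = Σ_{n≥0} Cat_n z^n`, viewed in `ℤ[[s,z]]`. -/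
noncomputable def Cgf : MvPowerSeries (Fin 2) ℤ := fun d =>
  if d 0 = 0 then (catalan (d 1) : ℤ) else 0

namespace GD

open MvPowerSeries Finsupp

/-- The exponent of `s^k z^n`. -/
noncomputable def E (k n : ℕ) : Fin 2 →₀ ℕ := single 0 k + single 1 n

lemma E_zero (k n : ℕ) : E k n 0 = k := by simp [E]
lemma E_one (k n : ℕ) : E k n 1 = n := by simp [E]
lemma E_eta (d : Fin 2 →₀ ℕ) : E (d 0) (d 1) = d := by
  ext i; fin_cases i
  · exact E_zero _ _
  · exact E_one _ _

lemma c_zsucc (k n : ℕ) (f : MvPowerSeries (Fin 2) ℤ) :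
    coeff (E k (n + 1)) (X 1 * f) = coeff (E k n) f := by
  have h : E k (n + 1) = single 1 1 + E k n := by
    simp only [E, Finsupp.single_add]; abel
  rw [h, X_def, coeff_add_monomial_mul, one_mul]

lemma c_ssucc (k n : ℕ) (f : MvPowerSeries (Fin 2) ℤ) :
    coeff (E (k + 1) n) (X 0 * f) = coeff (E k n) f := by
  have h : E (k + 1) n = single 0 1 + E k n := by
    simp only [E, Finsupp.single_add]; abel
  rw [h, X_def, coeff_add_monomial_mul, one_mul]

lemma c_zzero (k : ℕ) (f : MvPowerSeries (Fin 2) ℤ) :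
    coeff (E k 0) (X 1 * f) = 0 := by
  rw [X_def, coeff_monomial_mul, if_neg]
  intro h
  have := h 1
  simp [E] at this

lemma c_szero (n : ℕ) (f : MvPowerSeries (Fin 2) ℤ) :
    coeff (E 0 n) (X 0 * f) = 0 := by
  rw [X_def, coeff_monomial_mul, if_neg]
  intro h
  have := h 0
  simp [E] at this

lemma c_one (k n : ℕ) :
    coeff (E k n) (1 : MvPowerSeries (Fin 2) ℤ) = if k = 0 ∧ n = 0 then 1 else 0 := by
  rw [coeff_one]
  congr 1
  apply propext
  constructor
  · intro h
    exact ⟨by rw [← E_zero k n, h]; rfl, by rw [← E_one k n, h]; rfl⟩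
  · rintro ⟨rfl, rfl⟩; simp [E]

lemma c_Cgf (d : Fin 2 →₀ ℕ) :
    coeff d Cgf = if d 0 = 0 then (catalan (d 1) : ℤ) else 0 := rfl

lemma c_Cgf_sq (k n : ℕ) :
    coeff (E k n) (Cgf * Cgf) = if k = 0 then (catalan (n + 1) : ℤ) else 0 := by
  rw [coeff_mul]
  split_ifs with hk
  · subst hk
    have h : E 0 n = single 1 n := by simp [E]
    rw [h, Finsupp.antidiagonal_single, Finset.sum_map, catalan_succ']
    simp [c_Cgf]
  · apply Finset.sum_eq_zero
    intro p hp
    have h := Finset.HasAntidiagonal.mem_antidiagonal.1 hp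
    have h0 : p.1 0 + p.2 0 = k := by rw [← E_zero k n, ← h]; rfl
    rw [c_Cgf, c_Cgf]
    by_cases h1 : p.1 0 = 0
    · rw [if_neg (show p.2 0 ≠ 0 by omega)]; simp
    · rw [if_neg h1]; simp

lemma Cgf_eq : Cgf = 1 + X 1 * (Cgf * Cgf) := by
  ext d
  rw [← E_eta d, map_add, c_one]
  generalize d 0 = k
  generalize d 1 = n
  rw [c_Cgf, E_zero, E_one]
  cases n with
  | zero => rw [c_zzero]; simp
  | succ n => rw [c_zsucc, c_Cgf_sq]; simp

/-- Number of folded walks of length `n` from `e` to `0` with `k` flat steps at level `0`. -/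
def W : ℕ → ℤ → ℕ → ℕ
  | 0, e, k => if e = 0 ∧ k = 0 then 1 else 0
  | n + 1, e, k => W n (e + 1) k + W n (e - 1) k +
      2 * (if e = 0 then (if k = 0 then 0 else W n e (k - 1)) else W n e k)

/-- The denominator. -/
noncomputable def Den : MvPowerSeries (Fin 2) ℤ :=
  2 * (1 - X 0) * X 1 + 1 - 2 * X 1 * Cgf

lemma exists_inv : ∃ I : MvPowerSeries (Fin 2) ℤ, I * Den = 1 := by
  refine ⟨invOfUnit Den 1, invOfUnit_mul _ _ ?_⟩
  simp [Den]

/-- Solution of the kernel system. -/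
noncomputable def G (I : MvPowerSeries (Fin 2) ℤ) (e : ℤ) : MvPowerSeries (Fin 2) ℤ :=
  I * (Cgf - 1) ^ e.natAbs

lemma G_zero (I : MvPowerSeries (Fin 2) ℤ) (hI : I * Den = 1) :
    G I 0 = 1 + X 1 * (G I (0 + 1) + G I (0 - 1) + 2 * (X 0 * G I 0)) := by
  simp only [G]
  norm_num
  rw [Den] at hI
  linear_combination hI

lemma G_ne (I : MvPowerSeries (Fin 2) ℤ) (e : ℤ) (he : e ≠ 0) :
    G I e = X 1 * (G I (e + 1) + G I (e - 1) + 2 * G I e) := by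
  have key := Cgf_eq
  simp only [G]
  obtain ⟨m, hm⟩ : ∃ m, e.natAbs = m + 1 := ⟨e.natAbs - 1, by omega⟩
  rcases lt_or_gt_of_ne he with h | h
  · rw [hm, show (e + 1).natAbs = m by omega, show (e - 1).natAbs = m + 2 by omega]
    linear_combination (I * (Cgf - 1) ^ m) * key
  · rw [hm, show (e + 1).natAbs = m + 2 by omega, show (e - 1).natAbs = m by omega]
    linear_combination (I * (Cgf - 1) ^ m) * key

lemma c_two (d : Fin 2 →₀ ℕ) (f : MvPowerSeries (Fin 2) ℤ) :
    coeff d (2 * f) = 2 * coeff d f := by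
  rw [two_mul, map_add, two_mul]

lemma G_coeff (I : MvPowerSeries (Fin 2) ℤ) (hI : I * Den = 1) (n : ℕ) :
    ∀ (e : ℤ) (k : ℕ), coeff (E k n) (G I e) = W n e k := by
  induction n with
  | zero =>
    intro e k
    by_cases he : e = 0
    · subst he
      rw [G_zero I hI, map_add, c_zzero, c_one]; simp [W]
    · rw [G_ne I e he, c_zzero]; simp [W, he]
  | succ n ih =>
    intro e k
    by_cases he : e = 0
    · subst he
      rw [G_zero I hI, map_add, c_zsucc, c_one, map_add, map_add, c_two, ih, ih]
      cases k with
      | zero => rw [c_szero]; simp [W]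
      | succ k => rw [c_ssucc, ih]; simp [W]
    · rw [G_ne I e he, c_zsucc, map_add, map_add, c_two, ih, ih, ih]; simp [W, he]

/-- Step value. -/
def sg (b : Bool) : ℤ := if b then 1 else -1

lemma ht_zero (w : List Bool) : ht w 0 = 0 := by simp [ht]

lemma ht_cons (x : Bool) (w : List Bool) (j : ℕ) : ht (x :: w) (j + 1) = sg x + ht w j := by
  cases x <;> simp [ht, sg] <;> ring

lemma ht_app (w v : List Bool) (j : ℕ) (h : j ≤ w.length) : ht (w ++ v) j = ht w j := by
  simp [ht, List.take_append_of_le_length h]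

lemma ht_snoc (w : List Bool) (y : Bool) :
    ht (w ++ [y]) (w.length + 1) = ht w w.length + sg y := by
  have h : (w ++ [y]).take (w.length + 1) = w ++ [y] := List.take_of_length_le (by simp)
  simp only [ht, h, List.take_length]
  cases y <;> simp [sg, List.count_append] <;> ring

/-- Add a first and a last step. -/
def wrap (x y : Bool) (m : List Bool) : List Bool := x :: (m ++ [y])

lemma ht_wrap (x y : Bool) (m : List Bool) (j : ℕ) (h : j ≤ m.length) :
    ht (wrap x y m) (j + 1) = sg x + ht m j := by
  rw [wrap, ht_cons, ht_app _ _ _ h]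

lemma ht_wrap_last (x y : Bool) (m : List Bool) :
    ht (wrap x y m) (m.length + 2) = sg x + sg y + ht m m.length := by
  rw [wrap, ht_cons, ht_snoc]; ring

lemma ds_wrap (n : ℕ) (x y : Bool) (m : List Bool) (hm : m.length = 2 * n) :
    dsGD (n + 1) (wrap x y m) =
      dsGD n m + if ht m (2 * n) = 0 ∧ sg x + sg y = 0 then 1 else 0 := by
  have hl := ht_wrap_last x y m
  rw [hm] at hl
  unfold dsGD
  rw [Finset.card_filter, Finset.card_filter, ← Finset.sum_Ioc_add_eq_sum_Icc (by omega)]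
  congr 1
  · symm
    refine Finset.sum_bij (fun i _ => i + 1) ?_ ?_ ?_ ?_
    · intro i hi; simp at hi ⊢; omega
    · intro i _ j _ h; simpa using h
    · intro j hj
      simp at hj
      exact ⟨j - 1, by simp; omega, by omega⟩
    · intro i hi
      simp at hi
      obtain ⟨i, rfl⟩ : ∃ j, i = j + 1 := ⟨i - 1, by omega⟩
      rw [show i + 1 + 1 - 1 = i + 1 by omega,
        show 2 * (n + 1) + 1 - (i + 1 + 1) = (2 * n - i) + 1 by omega,
        show 2 * (n + 1) - (i + 1 + 1) = (2 * n - (i + 1)) + 1 by omega,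
        show i + 1 - 1 = i by omega,
        show 2 * n + 1 - (i + 1) = 2 * n - i by omega,
        ht_wrap _ _ _ _ (by omega), ht_wrap _ _ _ _ (by omega), ht_wrap _ _ _ _ (by omega),
        ht_wrap _ _ _ _ (by omega)]
      simp
  · rw [show 1 - 1 = 0 by omega, show 2 * (n + 1) + 1 - 1 = 2 * n + 2 by omega,
      show 2 * (n + 1) - 1 = 2 * n + 1 by omega, hl, ht_zero, ht_wrap _ _ _ _ (by omega)]
    rw [ht_wrap _ _ _ _ (by omega), ht_zero]
    congr 1
    apply propext
    constructor <;> rintro ⟨h1, h2⟩ <;> constructor <;> linarith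

/-- Words of length `2n` with end height `-2e` and degree of symmetry `k`. -/
def S (n : ℕ) (e : ℤ) (k : ℕ) : Set (List Bool) :=
  {w | w.length = 2 * n ∧ ht w (2 * n) = -2 * e ∧ dsGD n w = k}

lemma S_fin (n : ℕ) (e : ℤ) (k : ℕ) : (S n e k).Finite :=
  (List.finite_length_eq Bool (2 * n)).subset fun _ h => h.1

lemma wrap_inj (x y : Bool) : Function.Injective (wrap x y) := by
  intro a b h
  simpa [wrap] using h

/-- Middle words which wrap to flat pairs. -/
def T (n : ℕ) (e : ℤ) (k : ℕ) : Set (List Bool) :=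
  if e = 0 then (if k = 0 then ∅ else S n e (k - 1)) else S n e k

lemma T_fin (n : ℕ) (e : ℤ) (k : ℕ) : (T n e k).Finite := by
  unfold T
  split_ifs
  · exact Set.finite_empty
  · exact S_fin _ _ _
  · exact S_fin _ _ _

lemma mem_wrap (n : ℕ) (e : ℤ) (k : ℕ) (x y : Bool) (m : List Bool) :
    wrap x y m ∈ S (n + 1) e k ↔ m ∈ (if x = y then
      (if x then S n (e + 1) k else S n (e - 1) k) else T n e k) := by
  have hlen : (wrap x y m).length = 2 * (n + 1) ↔ m.length = 2 * n := by
    simp [wrap]; omega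
  by_cases hm : m.length = 2 * n
  · have hl := ht_wrap_last x y m
    rw [hm] at hl
    have hd := ds_wrap n x y m hm
    have h0 : wrap x y m ∈ S (n + 1) e k ↔ (sg x + sg y + ht m (2 * n) = -2 * e ∧
        dsGD n m + (if ht m (2 * n) = 0 ∧ sg x + sg y = 0 then 1 else 0) = k) := by
      simp only [S, Set.mem_ofPred_eq, hlen, hm, true_and]
      rw [show 2 * (n + 1) = 2 * n + 2 by ring, hl, hd]
    rw [h0]
    cases x <;> cases y <;> simp [sg, S, T, hm]
    · intros; constructor <;> intro h <;> linarith
    · split_ifs <;> simp_all <;> omega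
    · split_ifs <;> simp_all <;> omega
    · intros; constructor <;> intro h <;> linarith
  · have h0 : wrap x y m ∉ S (n + 1) e k := fun h => hm (hlen.1 h.1)
    simp only [h0, false_iff]
    unfold T
    split_ifs <;> first | exact fun h => hm h.1 | exact fun h => h

lemma exists_wrap (n : ℕ) (w : List Bool) (h : w.length = 2 * (n + 1)) :
    ∃ x y m, w = wrap x y m := by
  cases w with
  | nil => simp at h
  | cons x v =>
    have hv : v ≠ [] := by rintro rfl; simp at h; omega
    exact ⟨x, v.getLast hv, v.dropLast, by rw [wrap, List.dropLast_append_getLast hv]⟩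

lemma S_succ (n : ℕ) (e : ℤ) (k : ℕ) :
    S (n + 1) e k = (wrap true true '' S n (e + 1) k ∪ wrap false false '' S n (e - 1) k) ∪
      (wrap true false '' T n e k ∪ wrap false true '' T n e k) := by
  ext w
  constructor
  · intro h
    obtain ⟨x, y, m, rfl⟩ := exists_wrap n w h.1
    rw [mem_wrap] at h
    cases x <;> cases y <;> simp at h
    · exact Or.inl (Or.inr ⟨m, h, rfl⟩)
    · exact Or.inr (Or.inr ⟨m, h, rfl⟩)
    · exact Or.inr (Or.inl ⟨m, h, rfl⟩)
    · exact Or.inl (Or.inl ⟨m, h, rfl⟩)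
  · rintro ((⟨m, h, rfl⟩ | ⟨m, h, rfl⟩) | (⟨m, h, rfl⟩ | ⟨m, h, rfl⟩)) <;>
      rw [mem_wrap] <;> simpa using h

lemma wrap_disj (x y x' y' : Bool) (h : x ≠ x' ∨ y ≠ y') (P Q : Set (List Bool)) :
    Disjoint (wrap x y '' P) (wrap x' y' '' Q) := by
  rw [Set.disjoint_left]
  rintro _ ⟨a, _, rfl⟩ ⟨b, _, hb⟩
  simp only [wrap, List.cons.injEq] at hb
  have h2 := List.append_inj_right' hb.2 rfl
  simp at h2
  rcases h with h | h
  · exact h hb.1.symm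
  · exact h h2.symm

lemma S_card (n : ℕ) : ∀ (e : ℤ) (k : ℕ), (S n e k).ncard = W n e k := by
  induction n with
  | zero =>
    intro e k
    by_cases h : e = 0 ∧ k = 0
    · have : S 0 e k = {[]} := by
        ext w; simp [S, dsGD, h.1, h.2, ht]
      rw [this]; simp [W, h]
    · have : S 0 e k = ∅ := by
        ext w
        simp only [S, dsGD, ht, Set.mem_ofPred_eq, Set.mem_empty_iff_false, iff_false]
        rintro ⟨_, h1, h2⟩
        simp at h1 h2
        exact h ⟨h1, h2.symm⟩
      rw [this]; simp [W, h]
  | succ n ih =>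
    intro e k
    have hT : (T n e k).ncard =
        if e = 0 then (if k = 0 then 0 else W n e (k - 1)) else W n e k := by
      unfold T
      split_ifs
      · simp
      · exact ih _ _
      · exact ih _ _
    have f1 := (S_fin n (e + 1) k).image (wrap true true)
    have f2 := (S_fin n (e - 1) k).image (wrap false false)
    have f3 := (T_fin n e k).image (wrap true false)
    have f4 := (T_fin n e k).image (wrap false true)
    rw [S_succ, Set.ncard_union_eq _ (f1.union f2) (f3.union f4),
      Set.ncard_union_eq (wrap_disj _ _ _ _ (by simp) _ _) f1 f2,
      Set.ncard_union_eq (wrap_disj _ _ _ _ (by simp) _ _) f3 f4,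
      Set.ncard_image_of_injective _ (wrap_inj _ _), Set.ncard_image_of_injective _ (wrap_inj _ _),
      Set.ncard_image_of_injective _ (wrap_inj _ _), Set.ncard_image_of_injective _ (wrap_inj _ _),
      ih, ih, hT, W]
    · ring
    · rw [Set.disjoint_union_left, Set.disjoint_union_right, Set.disjoint_union_right]
      exact ⟨⟨wrap_disj _ _ _ _ (by simp) _ _, wrap_disj _ _ _ _ (by simp) _ _⟩,
        ⟨wrap_disj _ _ _ _ (by simp) _ _, wrap_disj _ _ _ _ (by simp) _ _⟩⟩

lemma grand_eq (n k : ℕ) : {w : List Bool | IsGrandDyck n w ∧ dsGD n w = k} = S n 0 k := by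
  ext w
  simp only [IsGrandDyck, S, Set.mem_ofPred_eq, and_assoc]
  refine and_congr_right fun hl => and_congr_left fun _ => ?_
  have h := List.count_true_add_count_false w
  have ht' : w.take (2 * n) = w := List.take_of_length_le (by omega)
  rw [ht, ht']
  omega

lemma A_eq (I : MvPowerSeries (Fin 2) ℤ) (hI : I * Den = 1) : A = I := by
  have hG : G I 0 = I := by simp [G]
  ext d
  have h := G_coeff I hI (d 1) 0 (d 0)
  rw [hG, E_eta] at h
  rw [h, ← S_card, ← grand_eq]
  rfl

end GD

/-- `A·(2(1−s)z + 1 − 2zC(z)) = 1` in `ℤ[[s,z]]`, i.e. `A = 1/(2(1−s)z + √(1−4z))`. -/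
theorem grandDyck_ds_gf :
    A * (2 * (1 - MvPowerSeries.X 0) * MvPowerSeries.X 1
      + 1 - 2 * MvPowerSeries.X 1 * Cgf) = 1 := by
  obtain ⟨I, hI⟩ := GD.exists_inv
  rw [GD.A_eq I hI]
  exact hI
end

section
/- For all n ≥ 0 and k ≥ 0, the number of partitions λ ∈ P^□_n with ds^□_n(λ) = k equals the number of grand Dyck paths P ∈ 𝒢_n with ds(P) = k. -/
/-- A partition in `P^□_n`, encoded as its zero-padded part sequence: an antitone function
`f : Fin n → ℕ` with all values at most `n` (so `f i = λ̃_{i+1}`). -/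
def IsBoxPartition (n : ℕ) (f : Fin n → ℕ) : Prop :=
  Antitone f ∧ ∀ i, f i ≤ n

/-- `conjAt n f i = λ̃'_i = #{j ∈ {1,…,n} : λ̃_j ≥ i}`, the `i`-th part of the conjugate of
the padded partition `f` inside the `n × n` square. -/
def conjAt (n : ℕ) (f : Fin n → ℕ) (i : ℕ) : ℕ :=
  (Finset.univ.filter fun j : Fin n => i ≤ f j).card

/-- The degree of symmetry of a partition inside the `n × n` square:
`ds^□_n(λ) = #{i ∈ {1,…,n} : λ̃_i = λ̃'_i}`. -/
def dsBox (n : ℕ) (f : Fin n → ℕ) : ℕ :=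
  (Finset.univ.filter fun i : Fin n => f i = conjAt n f (i.val + 1)).card

/-- Position (0-indexed) of the down step of row `i` in the boundary word. -/
def pPos (n : ℕ) (f : Fin n → ℕ) (i : Fin n) : ℕ := f i + (n - 1 - i.val)

/-- Boundary word of the partition. -/
def bword (n : ℕ) (f : Fin n → ℕ) : List Bool :=
  List.ofFn (fun j : Fin (2 * n) => decide (∀ i, pPos n f i ≠ j.val))

theorem count_false_take (w : List Bool) (m : ℕ) :
    (w.take m).count false = ((Finset.range m).filter fun j => w[j]? = some false).card := by
  induction m with
  | zero => simp
  | succ m ih =>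
    rw [List.take_add_one, List.count_append, ih, Finset.range_add_one, Finset.filter_insert]
    rcases h : w[m]? with _ | b
    · simp
    · cases b <;> simp

theorem count_add (l : List Bool) : l.count true + l.count false = l.length := by
  induction l with
  | nil => simp
  | cons a l ih => cases a <;> simp <;> omega

theorem bword_length (n : ℕ) (f : Fin n → ℕ) : (bword n f).length = 2 * n := by
  simp [bword]

theorem pPos_lt {n : ℕ} {f : Fin n → ℕ} (hf : IsBoxPartition n f) (i : Fin n) :
    pPos n f i < 2 * n := by
  have := hf.2 i
  have := i.isLt
  unfold pPos; omega

theorem pPos_anti {n : ℕ} {f : Fin n → ℕ} (hf : IsBoxPartition n f) {i j : Fin n} (h : i < j) :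
    pPos n f j < pPos n f i := by
  have := hf.1 h.le
  have := j.isLt
  have : i.val < j.val := h
  unfold pPos; omega

theorem pPos_lt_iff {n : ℕ} {f : Fin n → ℕ} (hf : IsBoxPartition n f) {i j : Fin n} :
    pPos n f j < pPos n f i ↔ i < j := by
  constructor
  · intro h
    by_contra hc
    rcases (not_lt.1 hc).lt_or_eq with h1 | h1
    · have := pPos_anti hf h1; omega
    · subst h1; omega
  · exact pPos_anti hf

theorem pPos_inj {n : ℕ} {f : Fin n → ℕ} (hf : IsBoxPartition n f) :
    Function.Injective (pPos n f) := by
  intro i j h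
  rcases lt_trichotomy i j with h1 | h1 | h1
  · have := pPos_anti hf h1; omega
  · exact h1
  · have := pPos_anti hf h1; omega

theorem bword_false {n : ℕ} {f : Fin n → ℕ} (hf : IsBoxPartition n f) (j : ℕ) :
    (bword n f)[j]? = some false ↔ ∃ i, pPos n f i = j := by
  by_cases hj : j < 2 * n
  · rw [List.getElem?_eq_getElem (by rw [bword_length]; exact hj)]
    simp [bword]
  · rw [List.getElem?_eq_none (by rw [bword_length]; omega)]
    simp only [reduceCtorEq, false_iff]
    rintro ⟨i, rfl⟩
    exact hj (pPos_lt hf i)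

/-- number of down steps among the first `m`. -/
def dn (n : ℕ) (f : Fin n → ℕ) (m : ℕ) : ℕ :=
  (Finset.univ.filter fun i : Fin n => pPos n f i < m).card

theorem bword_count {n : ℕ} {f : Fin n → ℕ} (hf : IsBoxPartition n f) (m : ℕ) :
    ((bword n f).take m).count false = dn n f m := by
  rw [count_false_take, dn, ← Finset.card_image_of_injective _ (pPos_inj hf)]
  congr 1
  ext j
  simp only [Finset.mem_filter, Finset.mem_range, bword_false hf, Finset.mem_image,
    Finset.mem_univ, true_and]
  constructor
  · rintro ⟨h, i, rfl⟩; exact ⟨i, h, rfl⟩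
  · rintro ⟨i, h, rfl⟩; exact ⟨h, i, rfl⟩

theorem bword_grand {n : ℕ} {f : Fin n → ℕ} (hf : IsBoxPartition n f) :
    IsGrandDyck n (bword n f) := by
  refine ⟨bword_length n f, ?_⟩
  have h1 := bword_count hf (2 * n)
  rw [List.take_of_length_le (by rw [bword_length])] at h1
  have h2 : dn n f (2 * n) = n := by
    unfold dn
    rw [Finset.filter_true_of_mem (fun i _ => pPos_lt hf i)]
    simp
  have h3 := count_add (bword n f)
  rw [bword_length] at h3
  omega

theorem ht_bword {n : ℕ} {f : Fin n → ℕ} (hf : IsBoxPartition n f) {m : ℕ} (hm : m ≤ 2 * n) :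
    ht (bword n f) m = m - 2 * (dn n f m : ℤ) := by
  have h3 := count_add ((bword n f).take m)
  rw [List.length_take, bword_length, bword_count hf, min_eq_left hm] at h3
  unfold ht
  rw [bword_count hf]
  omega

theorem dn_succ_mem {n : ℕ} {f : Fin n → ℕ} (hf : IsBoxPartition n f) (i : Fin n) :
    dn n f (pPos n f i + 1) = n - i.val := by
  unfold dn
  rw [← Fin.card_Ici]
  congr 1
  ext j
  simp only [Finset.mem_filter, Finset.mem_univ, true_and, Finset.mem_Ici]
  have := pPos_lt_iff hf (i := j) (j := i)
  rw [← not_lt, ← this]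
  omega

theorem dn_mem {n : ℕ} {f : Fin n → ℕ} (hf : IsBoxPartition n f) (i : Fin n) :
    dn n f (pPos n f i) = n - 1 - i.val := by
  unfold dn
  rw [← Fin.card_Ioi]
  congr 1
  ext j
  simp only [Finset.mem_filter, Finset.mem_univ, true_and, Finset.mem_Ioi]
  exact pPos_lt_iff hf

theorem dn_succ_not {n : ℕ} {f : Fin n → ℕ} {m : ℕ} (h : ∀ i, pPos n f i ≠ m) :
    dn n f (m + 1) = dn n f m := by
  unfold dn
  congr 1
  ext j
  have := h j
  simp only [Finset.mem_filter, Finset.mem_univ, true_and]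
  omega

theorem conj_le (n : ℕ) (f : Fin n → ℕ) (c : ℕ) : conjAt n f c ≤ n := by
  have := Finset.card_filter_le (Finset.univ : Finset (Fin n)) (fun j => c ≤ f j)
  simpa [conjAt] using this

theorem conj_iff {n : ℕ} {f : Fin n → ℕ} (hf : IsBoxPartition n f) (c : ℕ) (j : Fin n) :
    c ≤ f j ↔ j.val < conjAt n f c := by
  unfold conjAt
  constructor
  · intro h
    have : Finset.Iic j ⊆ Finset.univ.filter fun j : Fin n => c ≤ f j := by
      intro k hk
      have := hf.1 (Finset.mem_Iic.1 hk)
      simp; omega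
    have := Finset.card_le_card this
    rw [Fin.card_Iic] at this
    omega
  · intro h
    by_contra hc
    have : (Finset.univ.filter fun j : Fin n => c ≤ f j) ⊆ Finset.Iio j := by
      intro k hk
      simp only [Finset.mem_filter, Finset.mem_univ, true_and] at hk
      rw [Finset.mem_Iio]
      by_contra hkj
      have := hf.1 (not_lt.1 hkj)
      omega
    have := Finset.card_le_card this
    rw [Fin.card_Iio] at this
    omega

/-- Position of the up step of column `i`. -/
def qPos (n : ℕ) (f : Fin n → ℕ) (i : Fin n) : ℕ := i.val + (n - conjAt n f (i.val + 1))

theorem p_ne_q {n : ℕ} {f : Fin n → ℕ} (hf : IsBoxPartition n f) (c i : Fin n) :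
    pPos n f i ≠ qPos n f c := by
  have := conj_iff hf (c.val + 1) i
  have := conj_le n f (c.val + 1)
  have := i.isLt
  unfold pPos qPos
  omega

theorem dn_q {n : ℕ} {f : Fin n → ℕ} (hf : IsBoxPartition n f) (c : Fin n) :
    dn n f (qPos n f c) + c.val = qPos n f c := by
  have h1 := conj_le n f (c.val + 1)
  have : dn n f (qPos n f c) = n - conjAt n f (c.val + 1) := by
    have h2 : (Finset.univ.filter fun i : Fin n => i.val < conjAt n f (c.val + 1)).card
        = conjAt n f (c.val + 1) := by
      conv_rhs => unfold conjAt
      congr 1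
      ext j
      simp [← conj_iff hf]
    have h3 := Finset.card_filter_add_card_filter_not (s := (Finset.univ : Finset (Fin n)))
      (fun i : Fin n => i.val < conjAt n f (c.val + 1))
    have h4 : dn n f (qPos n f c) =
      (Finset.univ.filter fun i : Fin n => ¬ i.val < conjAt n f (c.val + 1)).card := by
      unfold dn
      congr 1
      ext i
      have := conj_iff hf (c.val + 1) i
      have := i.isLt
      simp only [Finset.mem_filter, Finset.mem_univ, true_and]
      unfold pPos qPos
      omega
    simp only [Finset.card_univ, Fintype.card_fin] at h3
    omega
  unfold qPos at *
  omega

theorem q_inj {n : ℕ} {f : Fin n → ℕ} (hf : IsBoxPartition n f) :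
    Function.Injective (qPos n f) := by
  intro i j h
  have h1 := dn_q hf i
  have h2 := dn_q hf j
  rw [h] at h1
  exact Fin.ext (by omega)

theorem dn_le (n : ℕ) (f : Fin n → ℕ) (m : ℕ) : dn n f m ≤ n := by
  have := Finset.card_filter_le (Finset.univ : Finset (Fin n)) (fun j => pPos n f j < m)
  simpa [dn] using this

theorem sym_iff {n : ℕ} {f : Fin n → ℕ} (i : Fin n) :
    f i = conjAt n f (i.val + 1) ↔ pPos n f i + qPos n f i + 1 = 2 * n := by
  have := conj_le n f (i.val + 1)
  have := i.isLt
  unfold pPos qPos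
  omega

/-- every position is a `p` or a `q`. -/
theorem p_or_q {n : ℕ} {f : Fin n → ℕ} (hf : IsBoxPartition n f) {m : ℕ} (hm : m < 2 * n) :
    (∃ i, pPos n f i = m) ∨ ∃ i, qPos n f i = m := by
  have hd : Disjoint (Finset.univ.image (pPos n f)) (Finset.univ.image (qPos n f)) := by
    rw [Finset.disjoint_left]
    intro a ha hb
    simp only [Finset.mem_image, Finset.mem_univ, true_and] at ha hb
    obtain ⟨i, rfl⟩ := ha
    obtain ⟨j, hj⟩ := hb
    exact p_ne_q hf j i hj.symm
  have hc := Finset.card_union_of_disjoint hd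
  rw [Finset.card_image_of_injective _ (pPos_inj hf),
    Finset.card_image_of_injective _ (q_inj hf)] at hc
  simp only [Finset.card_univ, Fintype.card_fin] at hc
  have hs : Finset.univ.image (pPos n f) ∪ Finset.univ.image (qPos n f) ⊆ Finset.range (2 * n) := by
    intro a ha
    simp only [Finset.mem_union, Finset.mem_image, Finset.mem_univ, true_and] at ha
    rw [Finset.mem_range]
    rcases ha with ⟨i, rfl⟩ | ⟨i, rfl⟩
    · exact pPos_lt hf i
    · have := i.isLt
      unfold qPos; omega
  have he := Finset.eq_of_subset_of_card_le hs (by rw [hc]; simp; omega)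
  have : m ∈ Finset.range (2 * n) := by simpa using hm
  rw [← he] at this
  simpa using this

theorem ds_cond {n : ℕ} {f : Fin n → ℕ} (hf : IsBoxPartition n f) {m : ℕ} (hm : m ≤ n) :
    ht (bword n f) m = ht (bword n f) (2 * n - m) ↔ dn n f (2 * n - m) = dn n f m + (n - m) := by
  rw [ht_bword hf (by omega), ht_bword hf (by omega)]
  omega

theorem ds_eq {n : ℕ} {f : Fin n → ℕ} (hf : IsBoxPartition n f) :
    dsBox n f = dsGD n (bword n f) := by
  unfold dsBox dsGD
  apply Finset.card_bij (fun i _ => min (pPos n f i) (qPos n f i) + 1)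
  · intro i hi
    simp only [Finset.mem_filter, Finset.mem_univ, true_and] at hi
    rw [sym_iff] at hi
    have h1 := dn_q hf i
    have h2 := dn_succ_not (fun j => p_ne_q hf i j)
    have h3 := dn_mem hf i
    have h4 := dn_succ_mem hf i
    have hin := i.isLt
    simp only [Finset.mem_filter, Finset.mem_Icc]
    rcases le_total (pPos n f i) (qPos n f i) with h | h
    · rw [min_eq_left h]
      refine ⟨by omega, ?_⟩
      have e : 2 * n + 1 - (pPos n f i + 1) = 2 * n - pPos n f i := by omega
      rw [Nat.add_sub_cancel, e, ds_cond hf (by omega), ds_cond hf (by omega)]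
      have e1 : 2 * n - pPos n f i = qPos n f i + 1 := by omega
      have e2 : 2 * n - (pPos n f i + 1) = qPos n f i := by omega
      rw [e1, e2]
      omega
    · rw [min_eq_right h]
      refine ⟨by omega, ?_⟩
      have e : 2 * n + 1 - (qPos n f i + 1) = 2 * n - qPos n f i := by omega
      rw [Nat.add_sub_cancel, e, ds_cond hf (by omega), ds_cond hf (by omega)]
      have e1 : 2 * n - qPos n f i = pPos n f i + 1 := by omega
      have e2 : 2 * n - (qPos n f i + 1) = pPos n f i := by omega
      rw [e1, e2]
      omega
  · intro i _ j _ h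
    have h1 := p_ne_q hf i j
    have h2 := p_ne_q hf j i
    by_cases h3 : pPos n f i = pPos n f j
    · exact pPos_inj hf h3
    · apply q_inj hf
      omega
  · intro m hm
    simp only [Finset.mem_filter, Finset.mem_Icc] at hm
    obtain ⟨⟨hm1, hm2⟩, ha, hb⟩ := hm
    obtain ⟨m, rfl⟩ : ∃ k, m = k + 1 := ⟨m - 1, by omega⟩
    have e : 2 * n + 1 - (m + 1) = 2 * n - m := by omega
    rw [Nat.add_sub_cancel, e, ds_cond hf (by omega)] at ha
    rw [ds_cond hf (by omega)] at hb
    obtain ⟨r, hr⟩ : ∃ r, r = 2 * n - (m + 1) := ⟨_, rfl⟩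
    have hr' : 2 * n - m = r + 1 := by omega
    rw [hr'] at ha
    rw [← hr] at hb
    rcases p_or_q hf (m := m) (by omega) with ⟨i, hi⟩ | ⟨i, hi⟩ <;>
    rcases p_or_q hf (m := r) (by omega) with ⟨j, hj⟩ | ⟨j, hj⟩
    · have h1 := dn_mem hf i
      have h2 := dn_succ_mem hf i
      have h3 := dn_mem hf j
      have h4 := dn_succ_mem hf j
      rw [hi] at h1 h2
      rw [hj] at h3 h4
      have := i.isLt
      have := j.isLt
      omega
    · have h1 := dn_mem hf i
      have h2 := dn_succ_mem hf i
      have h3 := dn_q hf j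
      have h4 := dn_succ_not (fun k => p_ne_q hf j k)
      rw [hi] at h1 h2
      rw [hj] at h3 h4
      have := i.isLt
      have := j.isLt
      have hij : i = j := Fin.ext (by omega)
      subst hij
      refine ⟨i, ?_, by omega⟩
      simp only [Finset.mem_filter, Finset.mem_univ, true_and]
      rw [sym_iff]; omega
    · have h1 := dn_mem hf j
      have h2 := dn_succ_mem hf j
      have h3 := dn_q hf i
      have h4 := dn_succ_not (fun k => p_ne_q hf i k)
      rw [hj] at h1 h2
      rw [hi] at h3 h4
      have := i.isLt
      have := j.isLt
      have hij : i = j := Fin.ext (by omega)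
      subst hij
      refine ⟨i, ?_, by omega⟩
      simp only [Finset.mem_filter, Finset.mem_univ, true_and]
      rw [sym_iff]; omega
    · have h1 := dn_succ_not (fun k => p_ne_q hf i k)
      have h2 := dn_succ_not (fun k => p_ne_q hf j k)
      rw [hi] at h1
      rw [hj] at h2
      omega

theorem bword_inj {n : ℕ} {f g : Fin n → ℕ} (hf : IsBoxPartition n f) (hg : IsBoxPartition n g)
    (h : bword n f = bword n g) : f = g := by
  funext i
  obtain ⟨j, hj⟩ := (bword_false hg _).1 (h ▸ (bword_false hf _).2 ⟨i, rfl⟩)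
  have h1 := bword_count hf (pPos n f i)
  have h2 := bword_count hg (pPos n f i)
  rw [h, h2, ← hj, dn_mem hg, hj, dn_mem hf] at h1
  have := i.isLt
  have := j.isLt
  have hij : i = j := Fin.ext (by omega)
  subst hij
  unfold pPos at hj
  omega

theorem strictMono_gap {n : ℕ} {g : Fin n → ℕ} (hg : StrictMono g) (a : Fin n) :
    ∀ d : ℕ, ∀ b : Fin n, b.val = a.val + d → g a + d ≤ g b := by
  intro d
  induction d with
  | zero => intro b hb; have : a = b := Fin.ext (by omega)
            subst this; simp
  | succ d ih =>
    intro b hb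
    have := b.isLt
    have h1 := ih ⟨a.val + d, by omega⟩ rfl
    have h2 : g ⟨a.val + d, by omega⟩ < g b := hg (by rw [Fin.lt_def]; simp; omega)
    omega

theorem bword_surj {n : ℕ} {w : List Bool} (hw : IsGrandDyck n w) :
    ∃ f, IsBoxPartition n f ∧ bword n f = w := by
  obtain ⟨hl, hc⟩ := hw
  have hS : ((Finset.range (2 * n)).filter fun j => w[j]? = some false).card = n := by
    rw [← count_false_take, List.take_of_length_le (by omega)]
    have := count_add w
    omega
  set S := (Finset.range (2 * n)).filter fun j => w[j]? = some false with hSdef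
  let g := S.orderEmbOfFin hS
  have hg : StrictMono g := (S.orderEmbOfFin hS).strictMono
  have hmem : ∀ k, g k ∈ S := fun k => S.orderEmbOfFin_mem hS k
  have hlt : ∀ k, g k < 2 * n := fun k => by
    have := hmem k
    rw [hSdef, Finset.mem_filter, Finset.mem_range] at this
    exact this.1
  have hge : ∀ k : Fin n, k.val ≤ g k := fun k => by
    have := strictMono_gap hg ⟨0, by have := k.isLt; omega⟩ k.val k (by simp)
    omega
  let f : Fin n → ℕ := fun i => g i.rev - i.rev.val
  have hp : ∀ i, pPos n f i = g i.rev := fun i => by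
    have h1 := hge i.rev
    have h2 : i.rev.val = n - (i.val + 1) := Fin.val_rev i
    simp only [pPos, f]
    omega
  have hf : IsBoxPartition n f := by
    constructor
    · intro i j hij
      have hij' : i.val ≤ j.val := hij
      have h1 := strictMono_gap hg j.rev (j.val - i.val) i.rev (by
        rw [Fin.val_rev, Fin.val_rev]; have := j.isLt; omega)
      have h2 := hge j.rev
      simp only [f]
      have := j.isLt
      rw [Fin.val_rev] at h2
      rw [Fin.val_rev, Fin.val_rev]
      omega
    · intro i
      have hi := i.isLt
      have h1 := strictMono_gap hg i.rev i.val ⟨n - 1, by omega⟩ (by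
        rw [Fin.val_rev]; simp; omega)
      have h2 := hlt ⟨n - 1, by omega⟩
      simp only [f]
      rw [Fin.val_rev]
      omega
  refine ⟨f, hf, ?_⟩
  have key : ∀ j : ℕ, (bword n f)[j]? = some false ↔ w[j]? = some false := by
    intro j
    rw [bword_false hf]
    have hr : (∃ i, pPos n f i = j) ↔ j ∈ S := by
      have h0 := S.range_orderEmbOfFin hS
      rw [← Finset.mem_coe, ← h0]
      constructor
      · rintro ⟨i, rfl⟩; exact ⟨i.rev, (hp i).symm⟩
      · rintro ⟨i, rfl⟩; exact ⟨i.rev, by rw [hp, Fin.rev_rev]⟩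
    rw [hr, hSdef, Finset.mem_filter, Finset.mem_range]
    constructor
    · exact fun h => h.2
    · intro h
      refine ⟨?_, h⟩
      obtain ⟨h', _⟩ := List.getElem?_eq_some_iff.1 h
      omega
  apply List.ext_getElem (by rw [bword_length, hl])
  intro j h1 h2
  have := key j
  rw [List.getElem?_eq_getElem h1, List.getElem?_eq_getElem h2] at this
  simp only [Option.some.injEq] at this
  cases h3 : (bword n f)[j] <;> cases h4 : w[j] <;> simp_all

/-- The number of partitions in `P^□_n` with `ds^□_n = k` equals the number of grand Dyck
paths of semilength `n` with degree of symmetry `k`. -/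
theorem boxPartition_ds_eq_grandDyck_ds (n k : ℕ) :
    {f : Fin n → ℕ | IsBoxPartition n f ∧ dsBox n f = k}.ncard
      = {w : List Bool | IsGrandDyck n w ∧ dsGD n w = k}.ncard := by
  apply Set.ncard_congr (fun f _ => bword n f)
  · rintro f ⟨hf, hk⟩
    exact ⟨bword_grand hf, by rw [← ds_eq hf, hk]⟩
  · rintro f g ⟨hf, _⟩ ⟨hg, _⟩ h
    exact bword_inj hf hg h
  · rintro w ⟨hw, hk⟩
    obtain ⟨f, hf, rfl⟩ := bword_surj hw
    exact ⟨f, ⟨hf, by rw [ds_eq hf, hk]⟩, rfl⟩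
end
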